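/- For all nonempty words ξ, ζ over 𝒜, the formula ▷ → \overrightarrow{ξζ} is derivable from the set of axioms R1 and R2 (for all letters a ∈ 𝒜) together with the formula ▷ → \overrightarrow{ξ} ∨ \overrightarrow{ζ}, by modus ponens and substitution. -/

import Mathlib

/-- Propositional formulas over the signature {→}. -/
inductive Fm : Type
  | var : ℕ → Fm
  | imp : Fm → Fm → Fm
  deriving DecidableEq

/-- Apply a substitution (uniform replacement of variables by formulas). -/
def Fm.subst (σ : ℕ → Fm) : Fm → Fm
  | var n => σ n
  | imp A B => imp (A.subst σ) (B.subst σ)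

/-- Derivability from a set of axioms by modus ponens and substitution. -/
inductive Deriv (P : Set Fm) : Fm → Prop
  | ax {A : Fm} : A ∈ P → Deriv P A
  | mp {A B : Fm} : Deriv P A → Deriv P (A.imp B) → Deriv P B
  | subst (σ : ℕ → Fm) {A : Fm} : Deriv P A → Deriv P (A.subst σ)

/-- The fixed variable x⁰. -/
def x0 : Fm := Fm.var 0

/-- Axioms of the intuitionistic implicational calculus Int_{→}:
A1: x → (y → x), A2: (x → (y → z)) → ((x → y) → (x → z)). -/
def IntAx : Set Fm :=
  { Fm.imp (Fm.var 0) (Fm.imp (Fm.var 1) (Fm.var 0)),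
    Fm.imp (Fm.imp (Fm.var 0) (Fm.imp (Fm.var 1) (Fm.var 2)))
      (Fm.imp (Fm.imp (Fm.var 0) (Fm.var 1)) (Fm.imp (Fm.var 0) (Fm.var 2))) }

/-- A ∨ B abbreviates (A → B) → B. -/
def orF (A B : Fm) : Fm := (A.imp B).imp B

/-- E 0 = x⁰ → x⁰ (i.e. E_1), E (k+1) = E k → x⁰. -/
def E : ℕ → Fm
  | 0 => x0.imp x0
  | n + 1 => (E n).imp x0

/-- The code of the letter a_i (letters are elements of `Fin m`). -/
def code {m : ℕ} (i : Fin m) : Fm := (E i.val).imp (x0.imp (x0.imp x0))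

/-- The formula ▷ = ((x⁰ → x⁰) → x⁰) → x⁰. -/
def tri : Fm := ((x0.imp x0).imp x0).imp x0

/-- Right-nested disjunction of a nonempty list of formulas. -/
def rlist : List Fm → Fm
  | [] => x0
  | [A] => A
  | A :: B :: Bs => orF A (rlist (B :: Bs))

def llistAux : Fm → List Fm → Fm
  | A, [] => A
  | A, B :: Bs => llistAux (orF A B) Bs

/-- Left-nested disjunction of a nonempty list of formulas. -/
def llist : List Fm → Fm
  | [] => x0
  | A :: As => llistAux A As

/-- \overrightarrow{α}: right-nested disjunction of codes of the letters of α. -/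
def rword {m : ℕ} (w : List (Fin m)) : Fm := rlist (w.map code)

/-- \overleftarrow{α}: left-nested disjunction of codes of the letters of α. -/
def lword {m : ℕ} (w : List (Fin m)) : Fm := llist (w.map code)

/-- A substitution instance of a member of M. -/
def SubStar (M : Set Fm) : Set Fm := {F | ∃ A ∈ M, ∃ σ : ℕ → Fm, F = Fm.subst σ A}

/-- Two formulas are unifiable if they have a common substitution instance. -/
def Unifiable (A B : Fm) : Prop := ∃ σ τ : ℕ → Fm, Fm.subst σ A = Fm.subst τ B

/-- The variable v occurs in a formula. -/
def Occurs (v : ℕ) : Fm → Prop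
  | Fm.var w => v = w
  | Fm.imp A B => Occurs v A ∨ Occurs v B

/-- Alphabetic formulas (𝒜-formulas) over the alphabet `Fin m`. -/
inductive AForm (m : ℕ) : Fm → Prop
  | ofCode (i : Fin m) : AForm m (code i)
  | ofOr {A B : Fm} : AForm m A → AForm m B → AForm m (orF A B)

/-- A tag system ⟨𝒜, 𝒲, d⟩ with 𝒜 = Fin m. -/
structure TagSystem where
  m : ℕ
  W : Fin m → List (Fin m)
  d : ℕ

/-- One production step of the tag system: a_i β γ ↦ γ ω_i, |β| = d - 1. -/
def TagStep (T : TagSystem) (ξ ζ : List (Fin T.m)) : Prop :=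
  ∃ (i : Fin T.m) (β γ : List (Fin T.m)),
    β.length = T.d - 1 ∧ ξ = i :: (β ++ γ) ∧ ζ = γ ++ T.W i

/-- ⟹_T : reflexive–transitive closure of the one-step production. -/
def TagSteps (T : TagSystem) : List (Fin T.m) → List (Fin T.m) → Prop :=
  Relation.ReflTransGen (TagStep T)

/-- T halts on α: α produces some word shorter than d. -/
def Halts (T : TagSystem) (α : List (Fin T.m)) : Prop :=
  ∃ β, TagSteps T α β ∧ β.length < T.d

/-- Axioms R1: (▷ → (y ∨ \overrightarrow{az}) ∨ u) → (▷ → (\overleftarrow{ya} ∨ z) ∨ u),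
with y = var 1, z = var 2, u = var 3. -/
def R1Ax (m : ℕ) : Set Fm :=
  {F | ∃ a : Fin m, F =
    (tri.imp (orF (orF (Fm.var 1) (orF (code a) (Fm.var 2))) (Fm.var 3))).imp
      (tri.imp (orF (orF (orF (Fm.var 1) (code a)) (Fm.var 2)) (Fm.var 3)))}

/-- Axioms R2: (▷ → \overleftarrow{ya} ∨ z) → (▷ → y ∨ \overrightarrow{az}). -/
def R2Ax (m : ℕ) : Set Fm :=
  {F | ∃ a : Fin m, F =
    (tri.imp (orF (orF (Fm.var 1) (code a)) (Fm.var 2))).imp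
      (tri.imp (orF (Fm.var 1) (orF (code a) (Fm.var 2))))}

/-- Axioms T1: (▷ → \overrightarrow{a_i α y}) → (▷ → \overrightarrow{y ω_i}), |α| = d - 1. -/
def T1Ax (T : TagSystem) : Set Fm :=
  {F | ∃ (i : Fin T.m) (α : List (Fin T.m)), α.length = T.d - 1 ∧
    F = (tri.imp (rlist (((i :: α).map code) ++ [Fm.var 1]))).imp
      (tri.imp (rlist (Fm.var 1 :: (T.W i).map code)))}

/-- Axioms T2: (▷ → \overrightarrow{a_i α}) → (▷ → \overrightarrow{ω_i}), |α| = d - 1. -/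
def T2Ax (T : TagSystem) : Set Fm :=
  {F | ∃ (i : Fin T.m) (α : List (Fin T.m)), α.length = T.d - 1 ∧
    F = (tri.imp (rword (i :: α))).imp (tri.imp (rword (T.W i)))}

/-- P_T = T1 ∪ T2 ∪ R1 ∪ R2. -/
def PT (T : TagSystem) : Set Fm := T1Ax T ∪ T2Ax T ∪ R1Ax T.m ∪ R2Ax T.m

/-- Axioms H: (▷ → \overrightarrow{α}) → A for 0 < |α| < d and A ∈ P₀. -/
def HAx (T : TagSystem) (P₀ : Finset Fm) : Set Fm :=
  {F | ∃ (α : List (Fin T.m)) (A : Fm), 0 < α.length ∧ α.length < T.d ∧ A ∈ P₀ ∧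
    F = (tri.imp (rword α)).imp A}

/-- P_{T,P₀} = P_T ∪ H. -/
def PTP (T : TagSystem) (P₀ : Finset Fm) : Set Fm := PT T ∪ HAx T P₀

/-- The calculus P_{T,ω,P₀} = {W_ω} ∪ P_T ∪ H. -/
def PTot (T : TagSystem) (ω : List (Fin T.m)) (P₀ : Finset Fm) : Set Fm :=
  insert (tri.imp (rword ω)) (PTP T P₀)

/-- Code(α): the four types of codes of a nonempty word α. -/
def CodeSet {m : ℕ} (α : List (Fin m)) : Set Fm :=
  {F | F = tri.imp (rword α)} ∪
  {F | ∃ α₁ α₂ : List (Fin m), α = α₁ ++ α₂ ∧ 2 ≤ α₁.length ∧ 1 ≤ α₂.length ∧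
    F = tri.imp (orF (rword α₁) (rword α₂))} ∪
  {F | ∃ α₁ α₂ α₃ : List (Fin m), α = α₁ ++ α₂ ++ α₃ ∧
    2 ≤ α₁.length ∧ 2 ≤ α₂.length ∧ 1 ≤ α₃.length ∧
    F = tri.imp (orF (orF (lword α₁) (rword α₂)) (rword α₃))} ∪
  {F | ∃ α₁ α₂ : List (Fin m), α = α₁ ++ α₂ ∧ 3 ≤ α₁.length ∧ 1 ≤ α₂.length ∧
    F = tri.imp (orF (lword α₁) (rword α₂))}

/-- Code_T(ω)*: substitution instances of codes of words produced from ω by T. -/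
def CodeTStar (T : TagSystem) (ω : List (Fin T.m)) : Set Fm :=
  {F | ∃ β, TagSteps T ω β ∧ F ∈ SubStar (CodeSet β)}

/-- ⟨P⟩: one application of modus ponens or substitution to members of P. -/
def StepSet (P : Set Fm) : Set Fm :=
  {B | ∃ A, A ∈ P ∧ A.imp B ∈ P} ∪ {B | ∃ A ∈ P, ∃ σ : ℕ → Fm, B = Fm.subst σ A}

/-- ⟨P⟩_n. -/
def Stages (P : Set Fm) : ℕ → Set Fm
  | 0 => P
  | n + 1 => StepSet (Stages P n)

/-- The substitution fixing x⁰ and sending y, z, u to the given formulas. -/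
def sub3 (Y Z U : Fm) : ℕ → Fm
  | 1 => Y
  | 2 => Z
  | 3 => U
  | n => Fm.var n

theorem subst_E (Y Z U : Fm) (n : ℕ) : (E n).subst (sub3 Y Z U) = E n := by
  induction n with
  | zero => rfl
  | succ n ih => simp only [E, Fm.subst, ih]; rfl

theorem subst_code (Y Z U : Fm) {m : ℕ} (a : Fin m) :
    (code a).subst (sub3 Y Z U) = code a := by
  simp only [code, Fm.subst, subst_E]; rfl

theorem subst_tri (Y Z U : Fm) : tri.subst (sub3 Y Z U) = tri := rfl

theorem subst_orF (σ : ℕ → Fm) (A B : Fm) :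
    (orF A B).subst σ = orF (A.subst σ) (B.subst σ) := rfl

theorem use_R1 {m : ℕ} {P : Set Fm} (hP : R1Ax m ⊆ P) (a : Fin m) (Y Z U : Fm)
    (h : Deriv P (tri.imp (orF (orF Y (orF (code a) Z)) U))) :
    Deriv P (tri.imp (orF (orF (orF Y (code a)) Z) U)) := by
  have key := Deriv.subst (sub3 Y Z U) (Deriv.ax (hP ⟨a, rfl⟩))
  simp only [Fm.subst, subst_orF, subst_code, subst_tri, sub3] at key
  exact Deriv.mp h key

theorem use_R2 {m : ℕ} {P : Set Fm} (hP : R2Ax m ⊆ P) (a : Fin m) (Y Z : Fm)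
    (h : Deriv P (tri.imp (orF (orF Y (code a)) Z))) :
    Deriv P (tri.imp (orF Y (orF (code a) Z))) := by
  have key := Deriv.subst (sub3 Y Z Z) (Deriv.ax (hP ⟨a, rfl⟩))
  simp only [Fm.subst, subst_orF, subst_code, subst_tri, sub3] at key
  exact Deriv.mp h key

theorem rword_cons {m : ℕ} (a : Fin m) (w : List (Fin m)) (hw : w ≠ []) :
    rword (a :: w) = orF (code a) (rword w) := by
  cases w with
  | nil => exact absurd rfl hw
  | cons b w => rfl

theorem reassoc {m : ℕ} {P : Set Fm} (h1 : R1Ax m ⊆ P) (h2 : R2Ax m ⊆ P)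
    (ζ : List (Fin m)) (hζ : ζ ≠ []) (w : List (Fin m)) :
    ∀ (c : Fin m) (Y : Fm), Deriv P (tri.imp (orF (orF Y (rword (c :: w))) (rword ζ))) →
      Deriv P (tri.imp (orF Y (rword (c :: w ++ ζ)))) := by
  induction w with
  | nil =>
    intro c Y h
    rw [List.cons_append, List.nil_append, rword_cons c ζ hζ]
    exact use_R2 h2 c Y _ h
  | cons d w ih =>
    intro c Y h
    rw [List.cons_append, rword_cons c _ (by simp)]
    rw [rword_cons c _ (by simp)] at h
    exact use_R2 h2 c Y _ (ih d _ (use_R1 h1 c Y _ _ h))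

/-- R1, R2, ▷ → \overrightarrow{ξ} ∨ \overrightarrow{ζ} ⊢ ▷ → \overrightarrow{ξζ},
    for nonempty ξ, ζ. -/
theorem stmt_10 (m : ℕ) (ξ ζ : List (Fin m)) (hξ : ξ ≠ []) (hζ : ζ ≠ []) :
    Deriv (R1Ax m ∪ R2Ax m ∪ {tri.imp (orF (rword ξ) (rword ζ))})
      (tri.imp (rword (ξ ++ ζ))) := by
  have h1 : R1Ax m ⊆ R1Ax m ∪ R2Ax m ∪ {tri.imp (orF (rword ξ) (rword ζ))} :=
    fun _ h => Or.inl (Or.inl h)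
  have h2 : R2Ax m ⊆ R1Ax m ∪ R2Ax m ∪ {tri.imp (orF (rword ξ) (rword ζ))} :=
    fun _ h => Or.inl (Or.inr h)
  have h0 : Deriv (R1Ax m ∪ R2Ax m ∪ {tri.imp (orF (rword ξ) (rword ζ))})
      (tri.imp (orF (rword ξ) (rword ζ))) := Deriv.ax (Or.inr rfl)
  generalize (R1Ax m ∪ R2Ax m ∪ {tri.imp (orF (rword ξ) (rword ζ))}) = P at h0 h1 h2 ⊢
  match ξ, hξ with
  | [a], _ =>
    rw [List.cons_append, List.nil_append, rword_cons a ζ hζ]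
    exact h0
  | a :: b :: w, _ =>
    rw [List.cons_append, rword_cons a _ (by simp)]
    rw [rword_cons a _ (by simp)] at h0
    exact reassoc h1 h2 ζ hζ w b _ h0
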